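/- Let S⃗ be a grounded universe of set separations with an order function |.|, let k ∈ ℕ, and let F be a family of stars of separations in S⃗_k that is fixed under shifting. If there exists an S_k-tree over F, then there exists a linked S_k-tree over F. -/

import Mathlib

open scoped Classical

noncomputable section

/-- An oriented separation of `V`: an ordered pair of subsets. -/
abbrev OSep (V : Type*) := Set V × Set V

namespace OSep

/-- The involution `(A,B)* = (B,A)`. -/
def flip {V : Type*} (s : OSep V) : OSep V := (s.2, s.1)

/-- The partial order `(A,B) ≤ (C,D) iff A ⊆ C and D ⊆ B`. -/
def le {V : Type*} (s t : OSep V) : Prop := s.1 ⊆ t.1 ∧ t.2 ⊆ s.2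

/-- The infimum `(A,B) ∧ (C,D) = (A ∩ C, B ∪ D)`. -/
def inter {V : Type*} (s t : OSep V) : OSep V := (s.1 ∩ t.1, s.2 ∪ t.2)

/-- The supremum `(A,B) ∨ (C,D) = (A ∪ C, B ∩ D)`. -/
def union {V : Type*} (s t : OSep V) : OSep V := (s.1 ∪ t.1, s.2 ∩ t.2)

end OSep

/-- A universe of set separations: a set of oriented separations (pairs covering `V`)
closed under the involution and under ∧ and ∨. -/
structure IsUniverse {V : Type*} (S : Set (OSep V)) : Prop where
  covers : ∀ s ∈ S, s.1 ∪ s.2 = Set.univ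
  flip_mem : ∀ s ∈ S, s.flip ∈ S
  inter_mem : ∀ s ∈ S, ∀ t ∈ S, s.inter t ∈ S
  union_mem : ∀ s ∈ S, ∀ t ∈ S, s.union t ∈ S

/-- An order function on a universe `S`: symmetric and submodular (non-negativity is
automatic for `ℕ`-valued functions). -/
structure IsOrderFun {V : Type*} (S : Set (OSep V)) (ord : OSep V → ℕ) : Prop where
  symm : ∀ s ∈ S, ord s.flip = ord s
  submod : ∀ s ∈ S, ∀ t ∈ S, ord (s.inter t) + ord (s.union t) ≤ ord s + ord t

/-- A universe with an order function is grounded if `|A ∪ C, B ∩ D| ≤ |C,D|`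
whenever `(B,A) ≤ (C,D)`. -/
def Grounded {V : Type*} (S : Set (OSep V)) (ord : OSep V → ℕ) : Prop :=
  ∀ s ∈ S, ∀ t ∈ S, OSep.le s.flip t → ord (s.union t) ≤ ord t

/-- A submodular function on subsets of `V`. -/
def Submodular {V : Type*} (r : Set V → ℕ) : Prop :=
  ∀ X Y : Set V, r (X ∩ Y) + r (X ∪ Y) ≤ r X + r Y

/-- The order function `|X,Y|_r = r(X) + r(Y) - r(V)` induced by `r`. -/
def ordOf {V : Type*} (r : Set V → ℕ) (s : OSep V) : ℕ := r s.1 + r s.2 - r Set.univ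

/-- A multiset of oriented separations is a star if `(A,B) ≤ (D,C)` for every two of its
members occupying distinct positions. -/
def IsStar {V : Type*} (σ : Multiset (OSep V)) : Prop :=
  ∀ a b : OSep V, (a ::ₘ {b}) ≤ σ → OSep.le a b.flip

/-- The size `⟨σ⟩_r = Σᵢ r(Bᵢ) − n · r(V)` of a star `σ = {(A₀,B₀),…,(Aₙ,Bₙ)}`. -/
def starSize {V : Type*} (r : Set V → ℕ) (σ : Multiset (OSep V)) : ℕ :=
  (σ.map fun s => r s.2).sum - (Multiset.card σ - 1) * r Set.univ

/-- `λ((A,B),(C,D)) = min { |X,Y| : (X,Y) ∈ S, (A,B) ≤ (X,Y) ≤ (C,D) }`. -/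
def lam {V : Type*} (S : Set (OSep V)) (ord : OSep V → ℕ) (a c : OSep V) : ℕ :=
  sInf (ord '' {s | s ∈ S ∧ OSep.le a s ∧ OSep.le s c})

/-- `(X,Y)` is linked to `(A,B)` if `(A,B) ≤ (X,Y)` and `|X,Y| = λ((A,B),(X,Y))`. -/
def IsLinkedSep {V : Type*} (S : Set (OSep V)) (ord : OSep V → ℕ) (a x : OSep V) : Prop :=
  x ∈ S ∧ OSep.le a x ∧ ord x = lam S ord a x

/-- `σ_t`: the multiset of labels of the oriented edges (darts) pointing towards `t`. -/
def starAt {W : Type*} [Fintype W] {V : Type*} (T : SimpleGraph W) (α : T.Dart → OSep V)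
    (t : W) : Multiset (OSep V) :=
  ((Finset.univ : Finset T.Dart).filter fun d => d.toProd.2 = t).val.map α

/-- The natural ordering on the oriented edges (darts) of a tree: `d ≤ d'` iff both lie
(in that direction) on the path from the tail of `d` to the head of `d'`. -/
def dartLE {W : Type*} (T : SimpleGraph W) (d d' : T.Dart) : Prop :=
  ∀ p : T.Walk d.toProd.1 d'.toProd.2, p.IsPath → d ∈ p.darts ∧ d' ∈ p.darts

/-- The vertex set of the subtree `T(e⃗)`: the component of `T - x` containing `y` together
with `x` itself, for `e⃗ = (x,y)`. -/
def shiftSet {W : Type*} (T : SimpleGraph W) (e : T.Dart) : Set W :=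
  {v | v = e.toProd.1 ∨ ∀ p : T.Walk e.toProd.1 v, p.IsPath → e ∈ p.darts}

/-- A dart of an induced subgraph, as a dart of the ambient graph. -/
def liftDart {W : Type*} {T : SimpleGraph W} {U : Set W} (d : (T.induce U).Dart) : T.Dart :=
  ⟨(d.toProd.1.val, d.toProd.2.val), d.adj⟩

/-- The labelling `α'` of the shift of `(T,α)` onto `(X,Y)` with respect to `e⃗`:
a dart `f` of `T(e⃗)` with `e⃗ ≤ f⃗` gets `α(f⃗) ∨ (X,Y)`, and the reverse darts get the
flipped labels. -/
def shiftAlpha {W : Type*} {V : Type*} (T : SimpleGraph W) (α : T.Dart → OSep V)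
    (e : T.Dart) (X : OSep V) : (T.induce (shiftSet T e)).Dart → OSep V :=
  fun d =>
    if dartLE T e (liftDart d) then (α (liftDart d)).union X
    else ((α (liftDart d).symm).union X).flip

/-- A family `F` of stars is fixed under shifting if for every tame `S`-tree `(T,α)`,
every oriented edge `e⃗ = (t,t')` of `T`, every vertex `s ≠ t` of `T(e⃗)` with
`α(F⃗_s) ∈ F`, and every `(X,Y)` linked to `α(e⃗)`, in the shift of `(T,α)` onto `(X,Y)`
with respect to `e⃗` one has `α'(F⃗_s) ∈ F`. -/
def FixedUnderShifting {V : Type*} (S : Set (OSep V)) (ord : OSep V → ℕ)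
    (F : Set (Multiset (OSep V))) : Prop :=
  ∀ (n : ℕ) (T : SimpleGraph (Fin n)) (α : T.Dart → OSep V) (e : T.Dart) (X : OSep V)
    (s : ↥(shiftSet T e)),
    T.IsTree → (∀ d, α d.symm = (α d).flip) → (∀ d, α d ∈ S) →
    (∀ t, IsStar (starAt T α t)) →
    (s : Fin n) ≠ e.toProd.1 → starAt T α (s : Fin n) ∈ F →
    IsLinkedSep S ord (α e) X →
    starAt (T.induce (shiftSet T e)) (shiftAlpha T α e X) s ∈ F

/-- A linked `S_k`-tree: for every two darts `e⃗ ≤ f⃗`, the minimum order of a label on the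
path from `e` to `f` equals `λ(α(e⃗), α(f⃗))`. -/
def IsLinkedTree {W : Type*} {V : Type*} (S : Set (OSep V)) (ord : OSep V → ℕ)
    (T : SimpleGraph W) (α : T.Dart → OSep V) : Prop :=
  ∀ e f : T.Dart, dartLE T e f →
    sInf ((fun g => ord (α g)) '' {g | dartLE T e g ∧ dartLE T g f}) =
      lam S ord (α e) (α f)

/-- An `F`-lean `S_k`-tree with respect to the ground function `r`. -/
def IsLeanTree {W : Type*} [Fintype W] {V : Type*} (S : Set (OSep V)) (ord : OSep V → ℕ)
    (r : Set V → ℕ) (T : SimpleGraph W) (α : T.Dart → OSep V)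
    (F : Set (Multiset (OSep V))) : Prop :=
  ∀ (t t' : W) (a b : OSep V), OSep.le a b.flip →
    (a ::ₘ starAt T α t) ∈ F → (b ::ₘ starAt T α t') ∈ F →
    (min (r a.1) (r b.1) ≤ lam S ord a b.flip ∨
      ∀ p : T.Walk t t', p.IsPath →
        sInf ((fun d => ord (α d)) '' {d | d ∈ p.darts}) = lam S ord a b.flip)

/-- `int(σ) = ⋂ᵢ Bᵢ` for `σ = {(A₀,B₀),…,(Aₙ,Bₙ)}`. -/
def intStar {V : Type*} (σ : Multiset (OSep V)) : Set V := {v | ∀ s ∈ σ, v ∈ s.2}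

/-- The universe of oriented separations of a graph `G`: pairs `(A,B)` of vertex sets with
`A ∪ B = V(G)` and no edge between `A ∖ B` and `B ∖ A`. -/
def graphSeps {V : Type*} (G : SimpleGraph V) : Set (OSep V) :=
  {s | s.1 ∪ s.2 = Set.univ ∧ ∀ a ∈ s.1 \ s.2, ∀ b ∈ s.2 \ s.1, ¬ G.Adj a b}

/-- `G` contains `k` vertex-disjoint `Z₁`–`Z₂` paths. -/
def HasDisjointPaths {V : Type*} (G : SimpleGraph V) (Z₁ Z₂ : Set V) (k : ℕ) : Prop :=
  ∃ (u v : Fin k → V) (p : ∀ i, G.Walk (u i) (v i)),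
    (∀ i, (p i).IsPath) ∧ (∀ i, u i ∈ Z₁) ∧ (∀ i, v i ∈ Z₂) ∧
    ∀ i j, i ≠ j → ∀ x, x ∈ (p i).support → x ∉ (p j).support

/-- `(T, B)` is a tree-decomposition of the graph `G`. -/
def IsTreeDecomp {V : Type*} {n : ℕ} (G : SimpleGraph V) (T : SimpleGraph (Fin n))
    (B : Fin n → Set V) : Prop :=
  T.IsTree ∧ (∀ v, ∃ t, v ∈ B t) ∧ (∀ u w, G.Adj u w → ∃ t, u ∈ B t ∧ w ∈ B t) ∧
  (∀ t₁ t₂ t₃ : Fin n, ∀ p : T.Walk t₁ t₃, p.IsPath → t₂ ∈ p.support → B t₁ ∩ B t₃ ⊆ B t₂)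

/-- The width of a tree-decomposition: `max |V_t| − 1`. -/
def tdWidth {V : Type*} {n : ℕ} (B : Fin n → Set V) : ℕ :=
  (Finset.univ.sup fun t => (B t).ncard) - 1

/-- The tree-width of a graph. -/
def treeWidth {V : Type*} (G : SimpleGraph V) : ℕ :=
  sInf {w | ∃ (n : ℕ) (T : SimpleGraph (Fin n)) (B : Fin n → Set V),
    IsTreeDecomp G T B ∧ tdWidth B = w}

/-- The path-width of a graph: minimum width of a tree-decomposition whose tree is a path. -/
def pathWidth {V : Type*} (G : SimpleGraph V) : ℕ :=
  sInf {w | ∃ (n : ℕ) (B : Fin n → Set V),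
    IsTreeDecomp G (SimpleGraph.pathGraph n) B ∧ tdWidth B = w}

/-- A linked tree-decomposition of a graph. -/
def IsLinkedDecomp {V : Type*} {n : ℕ} (G : SimpleGraph V) (T : SimpleGraph (Fin n))
    (B : Fin n → Set V) : Prop :=
  ∀ (k : ℕ) (t t' : Fin n),
    HasDisjointPaths G (B t) (B t') k ∨
    ∀ p : T.Walk t t', p.IsPath →
      ∃ d ∈ p.darts, (B d.toProd.1 ∩ B d.toProd.2).ncard < k

/-- A lean tree-decomposition of a graph. -/
def IsLeanDecomp {V : Type*} {n : ℕ} (G : SimpleGraph V) (T : SimpleGraph (Fin n))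
    (B : Fin n → Set V) : Prop :=
  ∀ (k : ℕ) (t t' : Fin n) (Z₁ Z₂ : Set V), Z₁ ⊆ B t → Z₂ ⊆ B t' →
    Z₁.ncard = k → Z₂.ncard = k →
    HasDisjointPaths G Z₁ Z₂ k ∨
    ∀ p : T.Walk t t', p.IsPath →
      ∃ d ∈ p.darts, (B d.toProd.1 ∩ B d.toProd.2).ncard < k
/-- The rank function of a matroid: `r(X)` is the maximum size of an independent subset
of `X`. -/
def mRank {α : Type*} (M : Matroid α) (X : Set α) : ℕ :=
  sSup {k | ∃ I, I ⊆ X ∧ M.Indep I ∧ I.ncard = k}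

/-- The connectivity `λ(X) = r(X) + r(E ∖ X) − r(E)` of `X ⊆ E`. -/
def mConn {α : Type*} (M : Matroid α) (X : Set α) : ℕ :=
  mRank M X + mRank M Xᶜ - mRank M Set.univ

/-- For a dart `d = (s,s')` of a tree `T`, the component of `T − s'` containing `s`. -/
def branch {W : Type*} (T : SimpleGraph W) (d : T.Dart) : Set W :=
  {w | ∀ p : T.Walk d.toProd.2 w, p.IsPath → d.toProd.1 ∈ p.support}

/-- The darts of `T` pointing towards `t`. -/
def dartsTo {W : Type*} [Fintype W] (T : SimpleGraph W) (t : W) : Finset T.Dart :=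
  Finset.univ.filter fun d => d.toProd.2 = t

/-- The width `Σᵢ r(E ∖ τ⁻¹(Tᵢ)) − (d−1)·r(E)` of the bag of a matroid tree-decomposition
at `v`, where the `Tᵢ` are the components of `T − v`. -/
def mBagWidth {α : Type*} {n : ℕ} (M : Matroid α) (T : SimpleGraph (Fin n))
    (τ : α → Fin n) (v : Fin n) : ℕ :=
  ((∑ d ∈ dartsTo T v, mRank M ((τ ⁻¹' branch T d)ᶜ)) + mRank M Set.univ)
    - (dartsTo T v).card * mRank M Set.univ

/-- The width of a matroid tree-decomposition: the maximum width of a bag. -/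
def mWidth {α : Type*} {n : ℕ} (M : Matroid α) (T : SimpleGraph (Fin n))
    (τ : α → Fin n) : ℕ :=
  Finset.univ.sup (mBagWidth M T τ)

/-- The tree-width of a matroid. -/
def matroidTreeWidth {α : Type*} (M : Matroid α) : ℕ :=
  sInf {w | ∃ (n : ℕ) (T : SimpleGraph (Fin n)) (_ : T.IsTree) (τ : α → Fin n),
    mWidth M T τ = w}

/-- `λ(Z₁,Z₂) = min {λ(X) : Z₁ ⊆ X ⊆ E ∖ Z₂}` for disjoint `Z₁, Z₂ ⊆ E`. -/
def mLam {α : Type*} (M : Matroid α) (Z₁ Z₂ : Set α) : ℕ :=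
  sInf (mConn M '' {X | Z₁ ⊆ X ∧ X ⊆ Z₂ᶜ})

/-- A lean matroid tree-decomposition. -/
def IsLeanMDecomp {α : Type*} {n : ℕ} (M : Matroid α) (T : SimpleGraph (Fin n))
    (τ : α → Fin n) : Prop :=
  ∀ (k : ℕ) (t t' : Fin n) (Z₁ Z₂ : Set α), Z₁ ⊆ τ ⁻¹' {t} → Z₂ ⊆ τ ⁻¹' {t'} →
    Disjoint Z₁ Z₂ → mRank M Z₁ = k → mRank M Z₂ = k →
    k ≤ mLam M Z₁ Z₂ ∨
    ∀ p : T.Walk t t', p.IsPath → ∃ d ∈ p.darts, mConn M (τ ⁻¹' branch T d) < k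

/-- A linked matroid tree-decomposition. -/
def IsLinkedMDecomp {α : Type*} {n : ℕ} (M : Matroid α) (T : SimpleGraph (Fin n))
    (τ : α → Fin n) : Prop :=
  ∀ e f : T.Dart, dartLE T e f →
    sInf ((fun g => mConn M (τ ⁻¹' branch T g)) '' {g | dartLE T e g ∧ dartLE T g f}) =
      sInf (mConn M '' {X | τ ⁻¹' branch T e ⊆ X ∧ X ⊆ τ ⁻¹' branch T f})
/-- Two oriented separations are nested if they have `≤`-comparable orientations. -/
def Nested {V : Type*} (s t : OSep V) : Prop :=
  OSep.le s t ∨ OSep.le s t.flip ∨ OSep.le s.flip t ∨ OSep.le s.flip t.flip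

/-- The component of `T - e` containing the head of the oriented edge `e`. -/
def side {W : Type*} (T : SimpleGraph W) (d : T.Dart) : Set W :=
  {v | (T.deleteEdges {s(d.fst, d.snd)}).Reachable d.snd v}

section Tree

variable {W : Type*} {T : SimpleGraph W}

theorem snd_mem_side (d : T.Dart) : d.snd ∈ side T d := SimpleGraph.Reachable.refl _

theorem fst_notMem_side (hT : T.IsTree) (d : T.Dart) : d.fst ∉ side T d := by
  have h := SimpleGraph.isAcyclic_iff_forall_adj_isBridge.1 hT.isAcyclic d.adj
  rw [SimpleGraph.isBridge_iff] at h
  exact fun h' => h h'.symm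

theorem mem_side_iff_of_adj (d : T.Dart) {v w : W} (h : T.Adj v w)
    (hne : s(v, w) ≠ s(d.fst, d.snd)) : v ∈ side T d ↔ w ∈ side T d := by
  have hadj : (T.deleteEdges {s(d.fst, d.snd)}).Adj v w := by
    rw [SimpleGraph.deleteEdges_adj]
    exact ⟨h, hne⟩
  exact ⟨fun h' => h'.trans hadj.reachable, fun h' => h'.trans hadj.symm.reachable⟩

theorem mem_side_symm (hT : T.IsTree) (d : T.Dart) (v : W) :
    v ∈ side T d.symm ↔ v ∉ side T d := by
  have hs : s(d.symm.fst, d.symm.snd) = s(d.fst, d.snd) := Sym2.eq_swap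
  constructor
  · intro h h'
    refine fst_notMem_side hT d ?_
    simp only [side, hs, Set.mem_ofPred_eq] at h h' ⊢
    exact h'.trans h.symm
  · intro hv
    have key : ∀ w, T.Reachable d.fst w → w ∈ side T d.symm ∨ w ∈ side T d := by
      intro w hw
      rw [SimpleGraph.reachable_iff_reflTransGen] at hw
      induction hw with
      | refl => exact Or.inl (snd_mem_side d.symm)
      | @tail b c _ hbc ih =>
        by_cases hne : s(b, c) = s(d.fst, d.snd)
        · rcases Sym2.eq_iff.1 hne with ⟨-, rfl⟩ | ⟨-, rfl⟩
          · exact Or.inr (snd_mem_side d)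
          · exact Or.inl (snd_mem_side d.symm)
        · exact ih.imp (mem_side_iff_of_adj d.symm hbc (by rwa [hs])).1
            (mem_side_iff_of_adj d hbc hne).1
    exact (key v (hT.connected.preconnected _ _)).resolve_right hv

theorem mem_darts_iff_mem_side (hT : T.IsTree) (d : T.Dart) {v : W} (p : T.Walk d.fst v)
    (hp : p.IsPath) : d ∈ p.darts ↔ v ∈ side T d := by
  have htail : ∀ {c : W} (h : T.Adj d.fst c) (q : T.Walk c v), d.fst ∉ q.support →
      (d ∈ (SimpleGraph.Walk.cons h q).darts ↔ c = d.snd) := by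
    intro c h q hq
    rw [SimpleGraph.Walk.darts_cons, List.mem_cons]
    constructor
    · rintro (h' | h')
      · rw [h']
      · exact absurd (q.dart_fst_mem_support_of_mem_darts h') hq
    · rintro rfl
      exact Or.inl (by ext <;> rfl)
  have hreach : ∀ {c : W} (q : T.Walk c v), d.fst ∉ q.support →
      (T.deleteEdges {s(d.fst, d.snd)}).Reachable c v := fun q hq =>
    SimpleGraph.reachable_deleteEdges_iff_exists_walk.2
      ⟨q, fun he => hq (q.fst_mem_support_of_mem_edges he)⟩
  cases p with
  | nil => simpa using fst_notMem_side hT d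
  | @cons _ c _ h q =>
    obtain ⟨-, hq⟩ := (SimpleGraph.Walk.cons_isPath_iff _ _).1 hp
    rw [htail h q hq]
    constructor
    · rintro rfl
      exact hreach q hq
    · intro hv
      by_contra hc
      refine fst_notMem_side hT d ((mem_side_iff_of_adj d h ?_).2 (hv.trans (hreach q hq).symm))
      rw [Ne, Sym2.eq_iff]
      rintro (⟨-, h'⟩ | ⟨h', -⟩)
      · exact hc h'
      · exact d.adj.ne h'

theorem exists_isPath (hT : T.IsTree) (v w : W) : ∃ p : T.Walk v w, p.IsPath :=
  (hT.existsUnique_path v w).exists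

theorem forall_isPath_mem_darts_iff (hT : T.IsTree) (d : T.Dart) (v : W) :
    (∀ p : T.Walk d.fst v, p.IsPath → d ∈ p.darts) ↔ v ∈ side T d := by
  constructor
  · intro h
    obtain ⟨p, hp⟩ := exists_isPath hT d.fst v
    exact (mem_darts_iff_mem_side hT d p hp).1 (h p hp)
  · exact fun h p hp => (mem_darts_iff_mem_side hT d p hp).2 h

theorem mem_shiftSet_iff (hT : T.IsTree) (e : T.Dart) (v : W) :
    v ∈ shiftSet T e ↔ v = e.fst ∨ v ∈ side T e := by
  rw [← forall_isPath_mem_darts_iff hT]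
  rfl

theorem symm_mem_darts_reverse {u v : W} (p : T.Walk u v) (d : T.Dart) :
    d.symm ∈ p.reverse.darts ↔ d ∈ p.darts := by
  rw [SimpleGraph.Walk.mem_darts_reverse, SimpleGraph.Dart.symm_symm]

theorem dartLE_iff_mem_side (hT : T.IsTree) (d d' : T.Dart) :
    dartLE T d d' ↔ d'.snd ∈ side T d ∧ d.fst ∉ side T d' := by
  have key : ∀ p : T.Walk d.fst d'.snd, p.IsPath →
      (d ∈ p.darts ∧ d' ∈ p.darts ↔ d'.snd ∈ side T d ∧ d.fst ∉ side T d') := by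
    intro p hp
    rw [mem_darts_iff_mem_side hT d p hp, ← mem_side_symm hT]
    exact and_congr_right' ((symm_mem_darts_reverse p d').symm.trans
      (mem_darts_iff_mem_side hT d'.symm p.reverse hp.reverse))
  constructor
  · intro h
    obtain ⟨p, hp⟩ := exists_isPath hT d.fst d'.snd
    exact (key p hp).1 (h p hp)
  · exact fun h p hp => (key p hp).2 h

theorem dartLE_iff_side_subset (hT : T.IsTree) (d d' : T.Dart) :
    dartLE T d d' ↔ side T d' ⊆ side T d := by
  rw [dartLE_iff_mem_side hT]
  constructor
  · rintro ⟨h1, h2⟩ v hv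
    have hv' : v ∈ side T d' := hv
    rw [side, Set.mem_ofPred_eq, SimpleGraph.reachable_iff_reflTransGen] at hv
    induction hv with
    | refl => exact h1
    | @tail b c hb hbc ih =>
      have hbm : b ∈ side T d' := (SimpleGraph.reachable_iff_reflTransGen _ _).2 hb
      refine (mem_side_iff_of_adj d (SimpleGraph.deleteEdges_adj.1 hbc).1 fun he => ?_).1 (ih hbm)
      rcases Sym2.eq_iff.1 he with ⟨rfl, -⟩ | ⟨-, rfl⟩
      · exact h2 hbm
      · exact h2 hv'
  · intro h
    exact ⟨h (snd_mem_side d'), fun h' => fst_notMem_side hT d (h h')⟩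

theorem dartLE_refl (hT : T.IsTree) (d : T.Dart) : dartLE T d d :=
  (dartLE_iff_side_subset hT _ _).2 subset_rfl

theorem dartLE_trans (hT : T.IsTree) {a b c : T.Dart} (h : dartLE T a b) (h' : dartLE T b c) :
    dartLE T a c := by
  rw [dartLE_iff_side_subset hT] at *
  exact h'.trans h

theorem dartLE_symm_symm (hT : T.IsTree) {a b : T.Dart} (h : dartLE T a b) :
    dartLE T b.symm a.symm := by
  rw [dartLE_iff_side_subset hT] at *
  intro v
  simp only [mem_side_symm hT]
  exact fun hv hv' => hv (h hv')

theorem not_dartLE_symm (hT : T.IsTree) {e g : T.Dart} (h : dartLE T e g) :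
    ¬ dartLE T e g.symm := by
  rw [dartLE_iff_side_subset hT] at *
  intro h'
  refine fst_notMem_side hT e ?_
  by_cases hg : e.fst ∈ side T g
  · exact h hg
  · exact h' ((mem_side_symm hT _ _).2 hg)

theorem dartLE_or_of_mem_shiftSet (hT : T.IsTree) {e g : T.Dart}
    (h1 : g.fst ∈ shiftSet T e) (h2 : g.snd ∈ shiftSet T e) :
    dartLE T e g ∨ dartLE T e g.symm := by
  by_cases heq : g.edge = e.edge
  · rcases (SimpleGraph.dart_edge_eq_iff _ _).1 heq with rfl | rfl
    · exact Or.inl (dartLE_refl hT _)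
    · exact Or.inr (by simpa using dartLE_refl hT e)
  · have hiff := mem_side_iff_of_adj e g.adj heq
    rw [mem_shiftSet_iff hT] at h1 h2
    have hmem : g.snd ∈ side T e ∧ g.fst ∈ side T e := by
      rcases h1 with h1 | h1
      · rcases h2 with h2 | h2
        · exact absurd (h1.trans h2.symm) g.adj.ne
        · exact ⟨h2, hiff.2 h2⟩
      · exact ⟨hiff.1 h1, h1⟩
    rw [dartLE_iff_mem_side hT, dartLE_iff_mem_side hT, mem_side_symm hT]
    by_cases he : e.fst ∈ side T g
    · exact Or.inr ⟨hmem.2, not_not.2 he⟩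
    · exact Or.inl ⟨hmem.1, he⟩

theorem dartLE_trichotomy (hT : T.IsTree) (g h : T.Dart) :
    (dartLE T g h ∨ dartLE T g h.symm) ∨ (dartLE T g.symm h ∨ dartLE T g.symm h.symm) := by
  by_cases heq : h.edge = g.edge
  · left
    rcases (SimpleGraph.dart_edge_eq_iff _ _).1 heq with rfl | rfl
    · exact Or.inl (dartLE_refl hT _)
    · exact Or.inr (by simpa using dartLE_refl hT g)
  · have hiff := mem_side_iff_of_adj g h.adj heq
    by_cases h1 : h.fst ∈ side T g
    · exact Or.inl (dartLE_or_of_mem_shiftSet hT ((mem_shiftSet_iff hT _ _).2 (Or.inr h1))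
        ((mem_shiftSet_iff hT _ _).2 (Or.inr (hiff.1 h1))))
    · exact Or.inr (dartLE_or_of_mem_shiftSet hT
        ((mem_shiftSet_iff hT _ _).2 (Or.inr ((mem_side_symm hT _ _).2 h1)))
        ((mem_shiftSet_iff hT _ _).2 (Or.inr ((mem_side_symm hT _ _).2 (mt hiff.2 h1)))))

/-- Two oriented edges above a common one are comparable or point away from each other. -/
theorem dartLE_or_dartLE_or_symm_dartLE (hT : T.IsTree) {e g h : T.Dart} (hg : dartLE T e g)
    (hh : dartLE T e h) : dartLE T g h ∨ dartLE T h g ∨ dartLE T g.symm h := by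
  rcases dartLE_trichotomy hT g h with (h' | h') | (h' | h')
  · exact Or.inl h'
  · exact absurd (dartLE_trans hT hg h') (not_dartLE_symm hT hh)
  · exact Or.inr (Or.inr h')
  · exact Or.inr (Or.inl (by simpa using dartLE_symm_symm hT h'))

theorem dartLE_of_snd_eq_fst (hT : T.IsTree) {d h : T.Dart} (hdh : d.snd = h.fst)
    (hne : d.fst ≠ h.snd) : dartLE T d h := by
  have hne' : s(d.fst, d.snd) ≠ s(h.fst, h.snd) := by
    rw [Ne, Sym2.eq_iff]
    rintro (⟨-, h2⟩ | ⟨h1, -⟩)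
    · exact h.adj.ne (hdh.symm.trans h2)
    · exact hne h1
  rw [dartLE_iff_mem_side hT, ← mem_side_iff_of_adj d h.adj hne'.symm, ← hdh,
    mem_side_iff_of_adj h d.adj hne', hdh]
  exact ⟨hdh ▸ snd_mem_side d, fst_notMem_side hT h⟩

/-- A transitive relation on oriented edges that holds between consecutive ones holds
between the first edge of a path and any later one. -/
theorem rel_of_mem_darts {R : T.Dart → T.Dart → Prop} (htrans : ∀ a b c, R a b → R b c → R a c)
    (hstep : ∀ d h : T.Dart, d.snd = h.fst → d.fst ≠ h.snd → R d h) {u v : W}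
    (p : T.Walk u v) (hp : p.IsPath) (d : T.Dart) (hd : d.snd = u) (hd' : d.fst ∉ p.support) :
    ∀ g ∈ p.darts, R d g := by
  induction p generalizing d with
  | nil => simp
  | @cons u c v h q ih =>
    obtain ⟨hq, hu⟩ := (SimpleGraph.Walk.cons_isPath_iff _ _).1 hp
    have hfirst : R d ⟨(u, c), h⟩ := by
      refine hstep _ _ hd fun hc => hd' ?_
      simp only [SimpleGraph.Walk.support_cons, List.mem_cons]
      exact Or.inr (hc ▸ q.start_mem_support)
    intro g hg
    rw [SimpleGraph.Walk.darts_cons, List.mem_cons] at hg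
    rcases hg with rfl | hg
    · exact hfirst
    · exact htrans _ _ _ hfirst (ih hq ⟨(u, c), h⟩ rfl hu g hg)

theorem eq_or_rel_of_mem_darts {R : T.Dart → T.Dart → Prop}
    (htrans : ∀ a b c, R a b → R b c → R a c)
    (hstep : ∀ d h : T.Dart, d.snd = h.fst → d.fst ≠ h.snd → R d h) {v : W} (d : T.Dart)
    (p : T.Walk d.fst v) (hp : p.IsPath) (hd : d ∈ p.darts) :
    ∀ g ∈ p.darts, g = d ∨ R d g := by
  cases p with
  | nil => simp at hd
  | @cons _ c _ h q =>
    obtain ⟨hq, hu⟩ := (SimpleGraph.Walk.cons_isPath_iff _ _).1 hp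
    rw [SimpleGraph.Walk.darts_cons, List.mem_cons] at hd
    obtain rfl | hd := hd.imp_left (fun h' => congrArg (fun x : T.Dart => x.snd) h')
    · intro g hg
      rw [SimpleGraph.Walk.darts_cons, List.mem_cons] at hg
      rcases hg with rfl | hg
      · exact Or.inl (by ext <;> rfl)
      · exact Or.inr (rel_of_mem_darts htrans hstep q hq d rfl hu g hg)
    · exact absurd (q.dart_fst_mem_support_of_mem_darts hd) hu

theorem dartLE_of_mem_darts (hT : T.IsTree) {v : W} (d : T.Dart) (p : T.Walk d.fst v)
    (hp : p.IsPath) (hd : d ∈ p.darts) {g : T.Dart} (hg : g ∈ p.darts) : dartLE T d g := by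
  rcases eq_or_rel_of_mem_darts (R := dartLE T) (fun _ _ _ => dartLE_trans hT)
    (fun _ _ => dartLE_of_snd_eq_fst hT) d p hp hd g hg with rfl | h
  · exact dartLE_refl hT _
  · exact h

theorem dartLE_of_mem_darts_between (hT : T.IsTree) {e f g : T.Dart} (hef : dartLE T e f)
    (p : T.Walk e.fst f.snd) (hp : p.IsPath) (hg : g ∈ p.darts) :
    dartLE T e g ∧ dartLE T g f := by
  refine ⟨dartLE_of_mem_darts hT e p hp (hef p hp).1 hg, ?_⟩
  have h := dartLE_of_mem_darts hT f.symm p.reverse hp.reverse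
    ((symm_mem_darts_reverse p f).2 (hef p hp).2) ((symm_mem_darts_reverse p g).2 hg)
  simpa using dartLE_symm_symm hT h

theorem induce_side_connected (d : T.Dart) : (T.induce (side T d)).Connected := by
  have key : ∀ v, ∀ hv : v ∈ side T d,
      (T.induce (side T d)).Reachable ⟨d.snd, snd_mem_side d⟩ ⟨v, hv⟩ := by
    intro v hv
    have hv' := (SimpleGraph.reachable_iff_reflTransGen _ _).1 hv
    induction hv' with
    | refl => exact SimpleGraph.Reachable.refl _
    | @tail b c hb hbc ih =>
      have hbm : b ∈ side T d := (SimpleGraph.reachable_iff_reflTransGen _ _).2 hb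
      have hadj : (T.induce (side T d)).Adj ⟨b, hbm⟩ ⟨c, hv⟩ :=
        (SimpleGraph.deleteEdges_adj.1 hbc).1
      exact (ih hbm).trans hadj.reachable
  have : Nonempty (side T d) := ⟨⟨d.snd, snd_mem_side d⟩⟩
  exact ⟨fun v w => (key v v.2).symm.trans (key w w.2)⟩

end Tree

theorem isAcyclic_sum {W₁ W₂ : Type*} {G : SimpleGraph W₁} {H : SimpleGraph W₂}
    (hG : G.IsAcyclic) (hH : H.IsAcyclic) : (G ⊕g H).IsAcyclic := by
  rw [SimpleGraph.isAcyclic_iff_forall_adj_isBridge] at *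
  rintro (a | a) (b | b) hab
  · intro hr
    refine hG (v := a) (w := b) hab ?_
    rw [SimpleGraph.reachable_iff_reflTransGen] at *
    have key : ∀ x, Relation.ReflTransGen
        (((G ⊕g H).deleteEdges {s(Sum.inl a, Sum.inl b)}).Adj) (Sum.inl a) x →
        ∃ y, x = Sum.inl y ∧ Relation.ReflTransGen (G.deleteEdges {s(a, b)}).Adj a y := by
      intro x hx
      induction hx with
      | refl => exact ⟨a, rfl, .refl⟩
      | @tail y z _ hyz ih =>
        obtain ⟨y, rfl, hy⟩ := ih
        rcases z with z | z
        · refine ⟨z, rfl, hy.tail ?_⟩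
          simpa [SimpleGraph.deleteEdges_adj] using hyz
        · simp [SimpleGraph.deleteEdges_adj] at hyz
    obtain ⟨y, hy, h⟩ := key _ hr
    cases hy
    exact h
  · simp at hab
  · simp at hab
  · intro hr
    refine hH (v := a) (w := b) hab ?_
    rw [SimpleGraph.reachable_iff_reflTransGen] at *
    have key : ∀ x, Relation.ReflTransGen
        (((G ⊕g H).deleteEdges {s(Sum.inr a, Sum.inr b)}).Adj) (Sum.inr a) x →
        ∃ y, x = Sum.inr y ∧ Relation.ReflTransGen (H.deleteEdges {s(a, b)}).Adj a y := by
      intro x hx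
      induction hx with
      | refl => exact ⟨a, rfl, .refl⟩
      | @tail y z _ hyz ih =>
        obtain ⟨y, rfl, hy⟩ := ih
        rcases z with z | z
        · simp [SimpleGraph.deleteEdges_adj] at hyz
        · refine ⟨z, rfl, hy.tail ?_⟩
          simpa [SimpleGraph.deleteEdges_adj] using hyz
    obtain ⟨y, hy, h⟩ := key _ hr
    cases hy
    exact h

theorem isTree_sum_sup_edge {W₁ W₂ : Type*} {G : SimpleGraph W₁} {H : SimpleGraph W₂}
    (hG : G.IsTree) (hH : H.IsTree) (a : W₁) (b : W₂) :
    ((G ⊕g H) ⊔ SimpleGraph.edge (Sum.inl a) (Sum.inr b)).IsTree :=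
  ⟨hG.connected.sum_sup_edge hH.connected,
    (isAcyclic_sum hG.isAcyclic hH.isAcyclic).sup_edge_of_not_reachable
      (SimpleGraph.not_reachable_sum_inl_inr a b)⟩

namespace OSep

variable {V : Type*}

theorem le_refl (s : OSep V) : le s s := ⟨subset_rfl, subset_rfl⟩

theorem le_trans {s t u : OSep V} (h : le s t) (h' : le t u) : le s u :=
  ⟨h.1.trans h'.1, h'.2.trans h.2⟩

theorem flip_le_flip {s t : OSep V} (h : le s t) : le t.flip s.flip := ⟨h.2, h.1⟩

theorem inter_le_left (s t : OSep V) : le (s.inter t) s :=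
  ⟨Set.inter_subset_left, Set.subset_union_left⟩

theorem inter_le_right (s t : OSep V) : le (s.inter t) t :=
  ⟨Set.inter_subset_right, Set.subset_union_right⟩

theorem le_inter {s t u : OSep V} (h : le s t) (h' : le s u) : le s (t.inter u) :=
  ⟨Set.subset_inter h.1 h'.1, Set.union_subset h.2 h'.2⟩

theorem union_eq_right {s t : OSep V} (h : le s t) : s.union t = t :=
  Prod.ext (Set.union_eq_right.2 h.1) (Set.inter_eq_right.2 h.2)

end OSep

section LinkedTree

variable {V : Type*} {S : Set (OSep V)} {ord : OSep V → ℕ}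

/-- `x` has minimum order among the separations of `S` between `a` and `c`. -/
def IsMinBetween (S : Set (OSep V)) (ord : OSep V → ℕ) (a c x : OSep V) : Prop :=
  x ∈ S ∧ OSep.le a x ∧ OSep.le x c ∧
    ∀ y ∈ S, OSep.le a y → OSep.le y c → ord x ≤ ord y

theorem exists_isMinBetween {a c : OSep V} (ha : a ∈ S) (hac : OSep.le a c) :
    ∃ x, IsMinBetween S ord a c x ∧ ord x = lam S ord a c := by
  have hne : (ord '' {s | s ∈ S ∧ OSep.le a s ∧ OSep.le s c}).Nonempty :=
    ⟨_, a, ⟨ha, OSep.le_refl a, hac⟩, rfl⟩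
  obtain ⟨x, ⟨hxS, hax, hxc⟩, hx⟩ := Nat.sInf_mem hne
  exact ⟨x, ⟨hxS, hax, hxc, fun y hy hay hyc => hx ▸ Nat.sInf_le ⟨y, ⟨hy, hay, hyc⟩, rfl⟩⟩, hx⟩

theorem lam_le {a c x : OSep V} (hx : x ∈ S) (hax : OSep.le a x) (hxc : OSep.le x c) :
    lam S ord a c ≤ ord x :=
  Nat.sInf_le ⟨x, ⟨hx, hax, hxc⟩, rfl⟩

namespace IsMinBetween

variable {a c x g : OSep V}

theorem flip (hU : IsUniverse S) (hord : IsOrderFun S ord) (hx : IsMinBetween S ord a c x) :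
    IsMinBetween S ord c.flip a.flip x.flip := by
  obtain ⟨hxS, hax, hxc, hmin⟩ := hx
  refine ⟨hU.flip_mem x hxS, OSep.flip_le_flip hxc, OSep.flip_le_flip hax, fun y hy hcy hya => ?_⟩
  rw [hord.symm x hxS, ← hord.symm y hy]
  exact hmin _ (hU.flip_mem y hy) (OSep.flip_le_flip hya) (OSep.flip_le_flip hcy)

theorem isLinkedSep (hx : IsMinBetween S ord a c x) : IsLinkedSep S ord a x := by
  obtain ⟨hxS, hax, hxc, hmin⟩ := hx
  refine ⟨hxS, hax, le_antisymm ?_ (lam_le hxS hax (OSep.le_refl x))⟩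
  exact le_csInf ⟨_, x, ⟨hxS, hax, OSep.le_refl x⟩, rfl⟩
    (by rintro _ ⟨y, ⟨hy, hay, hyx⟩, rfl⟩; exact hmin y hy hay (OSep.le_trans hyx hxc))

theorem of_ord_le (hx : IsMinBetween S ord a c x) {y : OSep V} (hy : y ∈ S) (hay : OSep.le a y)
    (hyc : OSep.le y c) (h : ord y ≤ ord x) : IsMinBetween S ord a c y :=
  ⟨hy, hay, hyc, fun z hz haz hzc => h.trans (hx.2.2.2 z hz haz hzc)⟩

theorem ord_union_le (hU : IsUniverse S) (hord : IsOrderFun S ord) (hx : IsMinBetween S ord a c x)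
    (hg : g ∈ S) (hag : OSep.le a g) : ord (g.union x) ≤ ord g := by
  have h1 := hord.submod g hg x hx.1
  have h2 := hx.2.2.2 _ (hU.inter_mem g hg x hx.1) (OSep.le_inter hag hx.2.1)
    (OSep.le_trans (OSep.inter_le_right g x) hx.2.2.1)
  omega

/-- If the supremum with `g` is not of smaller order than `g`, the infimum with `g` is also
a separation of minimum order. -/
theorem inter (hU : IsUniverse S) (hord : IsOrderFun S ord) (hx : IsMinBetween S ord a c x)
    (hg : g ∈ S) (hag : OSep.le a g) (h : ord g ≤ ord (g.union x)) :
    IsMinBetween S ord a c (g.inter x) := by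
  have h1 := hord.submod g hg x hx.1
  exact hx.of_ord_le (hU.inter_mem g hg x hx.1) (OSep.le_inter hag hx.2.1)
    (OSep.le_trans (OSep.inter_le_right g x) hx.2.2.1) (by omega)

theorem ord_copies_of_between (hU : IsUniverse S) (hord : IsOrderFun S ord)
    (hx : IsMinBetween S ord a c x) (hg : g ∈ S) :
    (ord (g.union x) < ord g ∧ ord (g.flip.union x.flip) < ord g) ∨
      ord (g.union x) ≤ ord x ∨ ord (g.flip.union x.flip) ≤ ord x := by
  have h1 := hord.submod g hg x hx.1
  have h2 : ord (g.flip.union x.flip) = ord (g.inter x) :=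
    hord.symm _ (hU.inter_mem g hg x hx.1)
  omega

/-- Among the separations of minimum order, one can be chosen so that every member of a given
family either is nested with it or strictly drops its order under both suprema. -/
theorem exists_uncrossed [Finite V] (hU : IsUniverse S) (hord : IsOrderFun S ord)
    (hx : IsMinBetween S ord a c x) {ι : Type*} [Finite ι] (γ : ι → OSep V)
    (hS : ∀ i, γ i ∈ S) (ha : ∀ i, OSep.le a (γ i)) (hc : ∀ i, OSep.le c.flip (γ i))
    (hnest : ∀ i j, OSep.le (γ i) (γ j) ∨ OSep.le (γ j) (γ i) ∨ OSep.le (γ i).flip (γ j)) :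
    ∃ y, IsMinBetween S ord a c y ∧ ∀ i, (OSep.le y (γ i) ∨ OSep.le y.flip (γ i)) ∨
      (ord ((γ i).union y) < ord (γ i) ∧ ord ((γ i).union y.flip) < ord (γ i)) := by
  let N : OSep V → Set ι := fun y => {i | OSep.le y (γ i) ∨ OSep.le y.flip (γ i)}
  obtain ⟨y, hy, hmax⟩ := Set.exists_max_image {y | IsMinBetween S ord a c y}
    (fun y => (N y).ncard) (Set.toFinite _) ⟨x, hx⟩
  refine ⟨y, hy, fun i => ?_⟩
  by_contra! hcon
  obtain ⟨⟨hn1, hn2⟩, hlt⟩ := hcon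
  have hiy : i ∉ N y := fun h => h.elim hn1 hn2
  have hgain : ∀ z, IsMinBetween S ord a c z → i ∈ N z → ¬ N y ⊆ N z := fun z hz hi hsub =>
    absurd (hmax z hz) (not_le.2 (Set.ncard_lt_ncard
      ((Set.ssubset_iff_of_subset hsub).2 ⟨i, hi, hiy⟩) (Set.toFinite _)))
  by_cases h1 : ord ((γ i).union y) < ord (γ i)
  · have hy' := (hy.flip hU hord).inter hU hord (hS i) (hc i) (hlt h1)
    refine hgain ((γ i).inter y.flip).flip (hy'.flip hU hord)
      (Or.inr (OSep.inter_le_left (γ i) y.flip)) fun j hj => ?_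
    rcases hj with hj | hj
    · rcases hnest i j with h | h | h
      · exact Or.inr (OSep.le_trans (OSep.inter_le_left _ _) h)
      · exact absurd (OSep.le_trans hj h) hn1
      · exact Or.inl ⟨Set.union_subset h.1 hj.1, Set.subset_inter h.2 hj.2⟩
    · exact Or.inr (OSep.le_trans (OSep.inter_le_right _ _) hj)
  · refine hgain _ (hy.inter hU hord (hS i) (ha i) (not_lt.1 h1))
      (Or.inl (OSep.inter_le_left (γ i) y)) fun j hj => ?_
    rcases hj with hj | hj
    · exact Or.inl (OSep.le_trans (OSep.inter_le_right _ _) hj)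
    · rcases hnest i j with h | h | h
      · exact Or.inl (OSep.le_trans (OSep.inter_le_left _ _) h)
      · exact absurd (OSep.le_trans hj h) hn2
      · exact Or.inr ⟨Set.union_subset h.1 hj.1, Set.subset_inter h.2 hj.2⟩

end IsMinBetween

theorem ord_union_flip_le (hU : IsUniverse S) (hord : IsOrderFun S ord) (hgr : Grounded S ord)
    {x g : OSep V} (hx : x ∈ S) (hg : g ∈ S) (h : OSep.le x g ∨ OSep.le x.flip g) :
    ord (g.union x) ≤ ord x ∨ ord (g.union x.flip) ≤ ord x := by
  rcases h with h | h
  · right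
    rw [← hord.symm x hx]
    exact hgr g hg _ (hU.flip_mem x hx) (OSep.flip_le_flip h)
  · exact Or.inl (hgr g hg x hx (OSep.flip_le_flip h))

section Count

/-- The number of pairs of steps of `R` whose tails are joined by a sequence of steps. -/
def linkCount {W : Type*} [Fintype W] (R : W → W → Prop) : ℕ :=
  Finset.card {q : (W × W) × (W × W) |
    R q.1.1 q.1.2 ∧ R q.2.1 q.2.2 ∧ Relation.ReflTransGen R q.1.1 q.2.1}

variable {W W' : Type*} {R : W → W → Prop} {R' : W' → W' → Prop}

theorem linkCount_mapsTo (φ : W' → W) (hom : ∀ a b, R' a b → R (φ a) (φ b)) :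
    ∀ q : (W' × W') × (W' × W'),
      (R' q.1.1 q.1.2 ∧ R' q.2.1 q.2.2 ∧ Relation.ReflTransGen R' q.1.1 q.2.1) →
      (R (φ q.1.1) (φ q.1.2) ∧ R (φ q.2.1) (φ q.2.2) ∧
        Relation.ReflTransGen R (φ q.1.1) (φ q.2.1)) :=
  fun _ h => ⟨hom _ _ h.1, hom _ _ h.2.1, h.2.2.lift φ hom⟩

theorem linkCount_injOn (φ : W' → W)
    (hinj : ∀ a b c d, R' a b → R' c d → φ a = φ c → φ b = φ d → a = c ∧ b = d) :
    Set.InjOn (Prod.map (Prod.map φ φ) (Prod.map φ φ))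
      {q : (W' × W') × (W' × W') |
        R' q.1.1 q.1.2 ∧ R' q.2.1 q.2.2 ∧ Relation.ReflTransGen R' q.1.1 q.2.1} := by
  rintro ⟨⟨a, b⟩, c, d⟩ ⟨h1, h2, -⟩ ⟨⟨a', b'⟩, c', d'⟩ ⟨h1', h2', -⟩ h
  simp only [Prod.map_apply, Prod.mk.injEq] at h
  obtain ⟨rfl, rfl⟩ := hinj _ _ _ _ h1 h1' h.1.1 h.1.2
  obtain ⟨rfl, rfl⟩ := hinj _ _ _ _ h2 h2' h.2.1 h.2.2
  rfl

theorem linkCount_le [Fintype W] [Fintype W'] (φ : W' → W)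
    (hom : ∀ a b, R' a b → R (φ a) (φ b))
    (hinj : ∀ a b c d, R' a b → R' c d → φ a = φ c → φ b = φ d → a = c ∧ b = d) :
    linkCount R' ≤ linkCount R := by
  refine Finset.card_le_card_of_injOn (Prod.map (Prod.map φ φ) (Prod.map φ φ)) ?_ ?_
  · intro q hq
    simpa using linkCount_mapsTo φ hom q (by simpa using hq)
  · simpa using linkCount_injOn φ hinj

theorem linkCount_lt [Fintype W] [Fintype W'] (φ : W' → W)
    (hom : ∀ a b, R' a b → R (φ a) (φ b))
    (hinj : ∀ a b c d, R' a b → R' c d → φ a = φ c → φ b = φ d → a = c ∧ b = d)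
    {a b c d : W} (hab : R a b) (hcd : R c d) (hac : Relation.ReflTransGen R a c)
    (hmiss : ∀ a' b' c' d', R' a' b' → R' c' d' → Relation.ReflTransGen R' a' c' →
      φ a' = a → φ b' = b → φ c' = c → φ d' = d → False) :
    linkCount R' < linkCount R := by
  rw [linkCount, ← Finset.card_image_of_injOn
    (f := Prod.map (Prod.map φ φ) (Prod.map φ φ)) (by simpa using linkCount_injOn φ hinj)]
  refine Finset.card_lt_card ((Finset.ssubset_iff_of_subset ?_).2 ⟨((a, b), (c, d)), ?_, ?_⟩)
  · intro q hq
    obtain ⟨q', hq', rfl⟩ := Finset.mem_image.1 hq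
    simpa using linkCount_mapsTo φ hom q' (by simpa using hq')
  · simpa using ⟨hab, hcd, hac⟩
  · intro hq
    obtain ⟨⟨⟨a', b'⟩, c', d'⟩, hq', h⟩ := Finset.mem_image.1 hq
    simp only [Prod.map_apply, Prod.mk.injEq] at h
    obtain ⟨h1, h2, h3⟩ := (Finset.mem_filter.1 hq').2
    exact hmiss a' b' c' d' h1 h2 h3 h.1.1 h.1.2 h.2.1 h.2.2

/-- Functions vanishing from `k` on are well-founded under lexicographic comparison from
the top. -/
theorem wellFounded_lexFromTop (k : ℕ) : WellFounded fun f g : ℕ → ℕ =>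
    (∀ p, k ≤ p → g p = 0) ∧ ∃ r, f r < g r ∧ ∀ p, r ≤ p → f p ≤ g p := by
  have hwf : WellFounded fun f g : Colex (Fin k → ℕ) => f < g := wellFounded_lt
  refine Subrelation.wf ?_ (InvImage.wf (fun f : ℕ → ℕ => toColex fun i : Fin k => f i) hwf)
  rintro f g ⟨hg, r, hr, hle⟩
  have hrk : ∀ p, f p < g p → p < k := fun p hp => by
    by_contra hkp
    have := hg p (not_lt.1 hkp)
    omega
  let P : ℕ → Prop := fun p => f p < g p
  have hm : P (Nat.findGreatest P k) := Nat.findGreatest_spec (hrk r hr).le hr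
  have hrm : r ≤ Nat.findGreatest P k := Nat.le_findGreatest (hrk r hr).le hr
  refine ⟨⟨Nat.findGreatest P k, hrk _ hm⟩, fun j hj => ?_, hm⟩
  have hj' : Nat.findGreatest P k < j := hj
  exact le_antisymm (hle j (by omega))
    (not_lt.1 (Nat.findGreatest_is_greatest (P := P) hj' j.2.le))

end Count

/-- A labelled tree over the family of stars `F`. -/
structure IsTreeOver (F : Set (Multiset (OSep V))) {W : Type*} [Fintype W]
    (T : SimpleGraph W) (α : T.Dart → OSep V) : Prop where
  isTree : T.IsTree
  symm : ∀ d, α d.symm = (α d).flip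
  mem : ∀ t, starAt T α t ∈ F

section Star

variable {W W' : Type*} [Fintype W] [Fintype W'] {T : SimpleGraph W} {α : T.Dart → OSep V}

theorem mem_starAt (d : T.Dart) : α d ∈ starAt T α d.snd :=
  Multiset.mem_map_of_mem α (by simp)

theorem starAt_eq_of_bij {T' : SimpleGraph W'} {α' : T'.Dart → OSep V} {t : W} {t' : W'}
    (φ : W' → W) (hφ : ∀ a, T'.Adj a t' → T.Adj (φ a) t)
    (hinj : ∀ a b, T'.Adj a t' → T'.Adj b t' → φ a = φ b → a = b)
    (hsurj : ∀ b, T.Adj b t → ∃ a, T'.Adj a t' ∧ φ a = b)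
    (hα : ∀ a (h' : T'.Adj a t') (h : T.Adj (φ a) t), α' ⟨(a, t'), h'⟩ = α ⟨(φ a, t), h⟩) :
    starAt T' α' t' = starAt T α t := by
  have hadj : ∀ d : T'.Dart, d ∈ (Finset.univ.filter fun d : T'.Dart => d.toProd.2 = t').val →
      T'.Adj d.fst t' := fun d hd => by
    obtain rfl : d.snd = t' := by simpa using hd
    exact d.adj
  refine Multiset.map_eq_map_of_bij_of_nodup _ _ (Finset.nodup _) (Finset.nodup _)
    (fun d hd => ⟨(φ d.fst, t), hφ _ (hadj d hd)⟩) ?_ ?_ ?_ ?_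
  · intro d hd
    simp
  · intro d hd d' hd' h
    have h1 := hinj _ _ (hadj d hd) (hadj d' hd')
      (congrArg (fun x : T.Dart => x.fst) h)
    have h2 : d.snd = t' := by simpa using hd
    have h3 : d'.snd = t' := by simpa using hd'
    exact SimpleGraph.Dart.ext _ _ (Prod.ext h1 (h2.trans h3.symm))
  · intro d hd
    obtain rfl : d.snd = t := by simpa using hd
    obtain ⟨a, ha, hab⟩ := hsurj d.fst d.adj
    exact ⟨⟨(a, t'), ha⟩, by simp, SimpleGraph.Dart.ext _ _ (Prod.ext hab rfl)⟩
  · intro d hd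
    obtain rfl : d.snd = t' := by simpa using hd
    exact hα _ _ _

theorem le_flip_of_isStar {d h : T.Dart} (hstar : IsStar (starAt T α h.snd)) (hne : d ≠ h)
    (heq : d.snd = h.snd) : OSep.le (α d) (α h).flip := by
  refine hstar _ _ ?_
  have hsub : (d ::ₘ {h}) ≤ (Finset.univ.filter fun d' : T.Dart => d'.toProd.2 = h.snd).val := by
    rw [Multiset.le_iff_subset (by simpa using hne)]
    intro x hx
    rcases Multiset.mem_cons.1 hx with rfl | hx
    · simpa using heq
    · simp [Multiset.mem_singleton.1 hx]
  simpa [starAt] using Multiset.map_le_map (f := α) hsub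

end Star

namespace IsTreeOver

variable {F : Set (Multiset (OSep V))} {W : Type*} [Fintype W] {T : SimpleGraph W}
  {α : T.Dart → OSep V}

theorem label_mem {k : ℕ} (h : IsTreeOver F T α)
    (hF : ∀ σ ∈ F, IsStar σ ∧ ∀ s ∈ σ, s ∈ S ∧ ord s < k) (d : T.Dart) :
    α d ∈ S ∧ ord (α d) < k :=
  (hF _ (h.mem d.snd)).2 _ (mem_starAt d)

theorem label_le (h : IsTreeOver F T α) (hF : ∀ σ ∈ F, IsStar σ) {d d' : T.Dart}
    (hdd : dartLE T d d') : OSep.le (α d) (α d') := by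
  obtain ⟨p, hp⟩ := exists_isPath h.isTree d.fst d'.snd
  obtain ⟨hd, hd'⟩ := hdd p hp
  have hstep : ∀ a b : T.Dart, a.snd = b.fst → a.fst ≠ b.snd → OSep.le (α a) (α b) :=
    fun a b hab hne => by
      have := le_flip_of_isStar (α := α) (d := a) (h := b.symm) (hF _ (h.mem _))
        (fun he => hne (congrArg (fun x : T.Dart => x.fst) he)) hab
      rwa [h.symm] at this
  rcases eq_or_rel_of_mem_darts (R := fun a b => OSep.le (α a) (α b))
    (fun _ _ _ => OSep.le_trans) hstep d p hp hd d' hd' with rfl | h'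
  · exact OSep.le_refl _
  · exact h'

end IsTreeOver

section Shift

variable {W : Type*} {T : SimpleGraph W} {α : T.Dart → OSep V}

/-- The labels of the shift onto `x` with respect to `e`, as a function on all oriented edges
of the ambient tree. -/
def shiftLabel (T : SimpleGraph W) (α : T.Dart → OSep V) (e : T.Dart) (x : OSep V)
    (d : T.Dart) : OSep V :=
  if dartLE T e d then (α d).union x else ((α d.symm).union x).flip

theorem shiftLabel_of_dartLE {e d : T.Dart} (h : dartLE T e d) (x : OSep V) :
    shiftLabel T α e x d = (α d).union x := if_pos h

theorem shiftLabel_self (hT : T.IsTree) {e : T.Dart} {x : OSep V} (h : OSep.le (α e) x) :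
    shiftLabel T α e x e = x := by
  rw [shiftLabel_of_dartLE (dartLE_refl hT e), OSep.union_eq_right h]

theorem shiftLabel_of_symm_dartLE (hT : T.IsTree) {e d : T.Dart} (h : dartLE T e d.symm)
    (x : OSep V) : shiftLabel T α e x d = ((α d.symm).union x).flip :=
  if_neg fun h' => not_dartLE_symm hT h' h

theorem shiftLabel_symm (hT : T.IsTree) {e d : T.Dart} (x : OSep V)
    (h : dartLE T e d ∨ dartLE T e d.symm) :
    shiftLabel T α e x d.symm = (shiftLabel T α e x d).flip := by
  rcases h with h | h
  · rw [shiftLabel_of_dartLE h, shiftLabel_of_symm_dartLE hT (by simpa using h)]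
    simp
  · rw [shiftLabel_of_dartLE h, shiftLabel_of_symm_dartLE hT h]
    rfl

theorem eq_fst_or_mem_side_of_adj (hT : T.IsTree) (e : T.Dart) {s v : W} (hs : s ∈ side T e)
    (h : T.Adj v s) : (v = e.fst ∧ s = e.snd) ∨ v ∈ side T e := by
  by_cases hne : s(v, s) = s(e.fst, e.snd)
  · rcases Sym2.eq_iff.1 hne with h' | ⟨-, rfl⟩
    · exact Or.inl h'
    · exact absurd hs (fst_notMem_side hT e)
  · exact Or.inr ((mem_side_iff_of_adj e h hne).2 hs)

theorem starAt_shiftAlpha [Fintype W] (hT : T.IsTree) (e : T.Dart) (x : OSep V)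
    [Fintype (shiftSet T e)] (s : shiftSet T e) (hs : (s : W) ∈ side T e) :
    starAt (T.induce (shiftSet T e)) (shiftAlpha T α e x) s =
      starAt T (shiftLabel T α e x) s := by
  refine starAt_eq_of_bij Subtype.val (fun a h => h) (fun a b _ _ => Subtype.ext) ?_ ?_
  · intro b hb
    refine ⟨⟨b, (mem_shiftSet_iff hT e b).2 ?_⟩, hb, rfl⟩
    exact (eq_fst_or_mem_side_of_adj hT e hs hb).imp_left And.left
  · intro a h' h
    rfl

end Shift

section Glue

variable {W : Type*} {T : SimpleGraph W}

/-- The tree obtained from the two subtrees that `d₁` and `d₂` point to by joining the heads of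
`d₁` and `d₂`. -/
def glue (T : SimpleGraph W) (d₁ d₂ : T.Dart) : SimpleGraph (side T d₁ ⊕ side T d₂) :=
  (T.induce (side T d₁) ⊕g T.induce (side T d₂)) ⊔
    SimpleGraph.edge (Sum.inl ⟨d₁.snd, snd_mem_side d₁⟩) (Sum.inr ⟨d₂.snd, snd_mem_side d₂⟩)

/-- The labels of the glued tree: those of the two subtrees, and `x` on the new edge. -/
def glueLabel {A B : Set W} (T : SimpleGraph W) (L₁ L₂ : T.Dart → OSep V) (x : OSep V) :
    A ⊕ B → A ⊕ B → OSep V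
  | .inl v, .inl w => if h : T.Adj v w then L₁ ⟨(v, w), h⟩ else x
  | .inr v, .inr w => if h : T.Adj v w then L₂ ⟨(v, w), h⟩ else x
  | .inl _, .inr _ => x
  | .inr _, .inl _ => x.flip

variable {d₁ d₂ : T.Dart}

theorem glue_isTree (hT : T.IsTree) : (glue T d₁ d₂).IsTree :=
  isTree_sum_sup_edge ⟨induce_side_connected d₁, hT.isAcyclic.induce _⟩
    ⟨induce_side_connected d₂, hT.isAcyclic.induce _⟩ _ _

@[simp] theorem glue_adj_inl_inl {v w : side T d₁} :
    (glue T d₁ d₂).Adj (.inl v) (.inl w) ↔ T.Adj v w := by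
  simp [glue, SimpleGraph.edge_adj]

@[simp] theorem glue_adj_inr_inr {v w : side T d₂} :
    (glue T d₁ d₂).Adj (.inr v) (.inr w) ↔ T.Adj v w := by
  simp [glue, SimpleGraph.edge_adj]

@[simp] theorem glue_adj_inl_inr {v : side T d₁} {w : side T d₂} :
    (glue T d₁ d₂).Adj (.inl v) (.inr w) ↔ (v : W) = d₁.snd ∧ (w : W) = d₂.snd := by
  simp [glue, SimpleGraph.edge_adj, Subtype.ext_iff]

@[simp] theorem glue_adj_inr_inl {v : side T d₁} {w : side T d₂} :
    (glue T d₁ d₂).Adj (.inr w) (.inl v) ↔ (v : W) = d₁.snd ∧ (w : W) = d₂.snd := by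
  rw [SimpleGraph.adj_comm, glue_adj_inl_inr]

variable {L₁ L₂ : T.Dart → OSep V} {x : OSep V}

theorem starAt_glue_inl [Fintype W] (hT : T.IsTree) (h₁ : L₁ d₁ = x.flip) (s : side T d₁) :
    starAt (glue T d₁ d₂) (fun d => glueLabel T L₁ L₂ x d.fst d.snd) (.inl s) =
      starAt T L₁ s := by
  have hne : ∀ a : side T d₁, (a : W) ≠ d₁.fst := fun a h =>
    fst_notMem_side hT d₁ (h ▸ a.2)
  refine starAt_eq_of_bij (Sum.elim Subtype.val fun _ => d₁.fst) ?_ ?_ ?_ ?_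
  · rintro (a | b) h
    · simpa using h
    · rw [glue_adj_inr_inl] at h
      rw [h.1]
      exact d₁.adj
  · rintro (a | b) (a' | b') h h' hab
    · exact congrArg _ (Subtype.ext hab)
    · exact absurd hab (hne a)
    · exact absurd hab.symm (hne a')
    · rw [glue_adj_inr_inl] at h h'
      exact congrArg _ (Subtype.ext (h.2.trans h'.2.symm))
  · intro b hb
    rcases eq_fst_or_mem_side_of_adj hT d₁ s.2 hb with ⟨rfl, hs⟩ | hbs
    · exact ⟨.inr ⟨d₂.snd, snd_mem_side d₂⟩, by simpa using hs, rfl⟩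
    · exact ⟨.inl ⟨b, hbs⟩, by simpa using hb, rfl⟩
  · rintro (a | b) h' h
    · exact dif_pos h
    · rw [glue_adj_inr_inl] at h'
      refine h₁.symm.trans (congrArg L₁ (SimpleGraph.Dart.ext _ _ (Prod.ext rfl h'.1.symm)))

theorem starAt_glue_inr [Fintype W] (hT : T.IsTree) (h₂ : L₂ d₂ = x) (s : side T d₂) :
    starAt (glue T d₁ d₂) (fun d => glueLabel T L₁ L₂ x d.fst d.snd) (.inr s) =
      starAt T L₂ s := by
  have hne : ∀ a : side T d₂, (a : W) ≠ d₂.fst := fun a h =>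
    fst_notMem_side hT d₂ (h ▸ a.2)
  refine starAt_eq_of_bij (Sum.elim (fun _ => d₂.fst) Subtype.val) ?_ ?_ ?_ ?_
  · rintro (b | a) h
    · rw [glue_adj_inl_inr] at h
      rw [h.2]
      exact d₂.adj
    · simpa using h
  · rintro (b | a) (b' | a') h h' hab
    · rw [glue_adj_inl_inr] at h h'
      exact congrArg _ (Subtype.ext (h.1.trans h'.1.symm))
    · exact absurd hab.symm (hne a')
    · exact absurd hab (hne a)
    · exact congrArg _ (Subtype.ext hab)
  · intro b hb
    rcases eq_fst_or_mem_side_of_adj hT d₂ s.2 hb with ⟨rfl, hs⟩ | hbs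
    · exact ⟨.inl ⟨d₁.snd, snd_mem_side d₁⟩, by simpa using hs, rfl⟩
    · exact ⟨.inr ⟨b, hbs⟩, by simpa using hb, rfl⟩
  · rintro (b | a) h' h
    · rw [glue_adj_inl_inr] at h'
      refine h₂.symm.trans (congrArg L₂ (SimpleGraph.Dart.ext _ _ (Prod.ext rfl h'.2.symm)))
    · exact dif_pos h

theorem glueLabel_symm {A B : Set W}
    (hL₁ : ∀ d : T.Dart, d.fst ∈ A → d.snd ∈ A → L₁ d.symm = (L₁ d).flip)
    (hL₂ : ∀ d : T.Dart, d.fst ∈ B → d.snd ∈ B → L₂ d.symm = (L₂ d).flip)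
    {G : SimpleGraph (A ⊕ B)} (hG₁ : ∀ {v w : A}, G.Adj (.inl v) (.inl w) ↔ T.Adj v w)
    (hG₂ : ∀ {v w : B}, G.Adj (.inr v) (.inr w) ↔ T.Adj v w) {v w : A ⊕ B} (h : G.Adj v w) :
    glueLabel T L₁ L₂ x w v = (glueLabel T L₁ L₂ x v w).flip := by
  rcases v with v | v <;> rcases w with w | w
  · have h' : T.Adj v w := hG₁.1 h
    simpa [glueLabel, h', h'.symm] using hL₁ ⟨(v, w), h'⟩ v.2 w.2
  · rfl
  · rfl
  · have h' : T.Adj v w := hG₂.1 h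
    simpa [glueLabel, h', h'.symm] using hL₂ ⟨(v, w), h'⟩ v.2 w.2

end Glue

theorem dartLE_or_dartLE_symm_of_mem_side {W : Type*} {T : SimpleGraph W} (hT : T.IsTree)
    {e d : T.Dart} (h1 : d.fst ∈ side T e) (h2 : d.snd ∈ side T e) :
    dartLE T e d ∨ dartLE T e d.symm :=
  dartLE_or_of_mem_shiftSet hT ((mem_shiftSet_iff hT _ _).2 (Or.inr h1))
    ((mem_shiftSet_iff hT _ _).2 (Or.inr h2))

theorem shiftLabel_symm_of_mem_side {W : Type*} {T : SimpleGraph W} {α : T.Dart → OSep V}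
    (hT : T.IsTree) {e : T.Dart} (x : OSep V) {d : T.Dart} (h1 : d.fst ∈ side T e)
    (h2 : d.snd ∈ side T e) :
    shiftLabel T α e x d.symm = (shiftLabel T α e x d).flip :=
  shiftLabel_symm hT x (dartLE_or_dartLE_symm_of_mem_side hT h1 h2)

namespace IsTreeOver

variable {F : Set (Multiset (OSep V))} {k n : ℕ} {T : SimpleGraph (Fin n)}
  {α : T.Dart → OSep V}

theorem starAt_shiftLabel_mem (h : IsTreeOver F T α)
    (hF : ∀ σ ∈ F, IsStar σ ∧ ∀ s ∈ σ, s ∈ S ∧ ord s < k)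
    (hfix : FixedUnderShifting S ord F) {e : T.Dart} {x : OSep V}
    (hx : IsLinkedSep S ord (α e) x) {s : Fin n} (hs : s ∈ side T e) :
    starAt T (shiftLabel T α e x) s ∈ F := by
  have hT := h.isTree
  rw [← starAt_shiftAlpha hT e x ⟨s, (mem_shiftSet_iff hT e s).2 (Or.inr hs)⟩ hs]
  exact hfix n T α e x _ hT h.symm (fun d => (h.label_mem hF d).1)
    (fun t => (hF _ (h.mem t)).1) (fun he => fst_notMem_side hT e (he ▸ hs)) (h.mem s) hx

/-- Gluing the shifts onto `x` from below and from above along an edge labelled `x`. -/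
theorem glue (h : IsTreeOver F T α) (hU : IsUniverse S) (hord : IsOrderFun S ord)
    (hF : ∀ σ ∈ F, IsStar σ ∧ ∀ s ∈ σ, s ∈ S ∧ ord s < k)
    (hfix : FixedUnderShifting S ord F) {e f : T.Dart} {x : OSep V}
    (hx : IsMinBetween S ord (α e) (α f) x) :
    IsTreeOver F (glue T f.symm e) (fun d => glueLabel T (shiftLabel T α f.symm x.flip)
      (shiftLabel T α e x) x d.fst d.snd) := by
  have hT := h.isTree
  have hx' := hx.flip hU hord
  rw [← h.symm] at hx'
  refine ⟨glue_isTree hT, fun d => ?_, ?_⟩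
  · exact glueLabel_symm (fun _ => shiftLabel_symm_of_mem_side hT _)
      (fun _ => shiftLabel_symm_of_mem_side hT _) glue_adj_inl_inl glue_adj_inr_inr d.adj
  · rintro (s | s)
    · rw [starAt_glue_inl hT (shiftLabel_self hT hx'.2.1)]
      exact h.starAt_shiftLabel_mem hF hfix hx'.isLinkedSep s.2
    · rw [starAt_glue_inr hT (shiftLabel_self hT hx.2.1)]
      exact h.starAt_shiftLabel_mem hF hfix hx.isLinkedSep s.2

end IsTreeOver

/-- Adjacency in `T` along an edge whose label has order at least `p`. -/
def bigAdj {W : Type*} (T : SimpleGraph W) (α : T.Dart → OSep V) (ord : OSep V → ℕ) (p : ℕ)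
    (v w : W) : Prop :=
  ∃ h : T.Adj v w, p ≤ ord (α ⟨(v, w), h⟩)

theorem bigAdj_dart {W : Type*} {T : SimpleGraph W} {α : T.Dart → OSep V} {p : ℕ} {d : T.Dart}
    (h : p ≤ ord (α d)) : bigAdj T α ord p d.fst d.snd := ⟨d.adj, h⟩

theorem linkCount_bigAdj_eq_zero {W : Type*} [Fintype W] {T : SimpleGraph W}
    {α : T.Dart → OSep V} {p : ℕ} (h : ∀ d, ord (α d) < p) :
    linkCount (bigAdj T α ord p) = 0 := by
  rw [linkCount, Finset.card_eq_zero, Finset.filter_eq_empty_iff]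
  rintro q - ⟨⟨h', hp⟩, -⟩
  exact absurd hp (not_le.2 (h _))

theorem reflTransGen_bigAdj_of_walk {W : Type*} {T : SimpleGraph W} {α : T.Dart → OSep V}
    {p : ℕ} {u v : W} (q : T.Walk u v) (h : ∀ d ∈ q.darts, p ≤ ord (α d)) :
    Relation.ReflTransGen (bigAdj T α ord p) u v := by
  induction q with
  | nil => exact .refl
  | cons hadj q ih =>
    exact .head ⟨hadj, h _ (by simp)⟩ (ih fun d hd => h d (by simp [hd]))

section Glue

variable {W : Type*} {T : SimpleGraph W} {d₁ d₂ : T.Dart} {α L₁ L₂ : T.Dart → OSep V}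
  {x : OSep V} {p : ℕ}

theorem bigAdj_glue (hx : ord x < p) (hx' : ord x.flip < p) {v w : side T d₁ ⊕ side T d₂}
    (h : bigAdj (glue T d₁ d₂) (fun d => glueLabel T L₁ L₂ x d.fst d.snd) ord p v w) :
    (∃ a b : side T d₁, v = .inl a ∧ w = .inl b ∧ bigAdj T L₁ ord p a b) ∨
      ∃ a b : side T d₂, v = .inr a ∧ w = .inr b ∧ bigAdj T L₂ ord p a b := by
  obtain ⟨hadj, hp⟩ := h
  rcases v with v | v <;> rcases w with w | w
  · have h' : T.Adj v w := glue_adj_inl_inl.1 hadj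
    exact Or.inl ⟨v, w, rfl, rfl, h', by simpa [glueLabel, h'] using hp⟩
  · exact absurd hp (not_le.2 hx)
  · exact absurd hp (not_le.2 hx')
  · have h' : T.Adj v w := glue_adj_inr_inr.1 hadj
    exact Or.inr ⟨v, w, rfl, rfl, h', by simpa [glueLabel, h'] using hp⟩

theorem isLeft_eq_of_reflTransGen (hx : ord x < p) (hx' : ord x.flip < p)
    {v w : side T d₁ ⊕ side T d₂} (h : Relation.ReflTransGen
      (bigAdj (glue T d₁ d₂) (fun d => glueLabel T L₁ L₂ x d.fst d.snd) ord p) v w) :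
    v.isLeft = w.isLeft := by
  induction h with
  | refl => rfl
  | tail _ h ih =>
    rcases bigAdj_glue hx hx' h with ⟨a, b, rfl, rfl, -⟩ | ⟨a, b, rfl, rfl, -⟩ <;> exact ih

theorem bigAdj_glue_hom (hx : ord x < p) (hx' : ord x.flip < p)
    (h₁ : ∀ d : T.Dart, d.fst ∈ side T d₁ → d.snd ∈ side T d₁ → ord (L₁ d) ≤ ord (α d))
    (h₂ : ∀ d : T.Dart, d.fst ∈ side T d₂ → d.snd ∈ side T d₂ → ord (L₂ d) ≤ ord (α d))
    (v w : side T d₁ ⊕ side T d₂)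
    (h : bigAdj (glue T d₁ d₂) (fun d => glueLabel T L₁ L₂ x d.fst d.snd) ord p v w) :
    bigAdj T α ord p (Sum.elim Subtype.val Subtype.val v) (Sum.elim Subtype.val Subtype.val w) := by
  rcases bigAdj_glue hx hx' h with ⟨a, b, rfl, rfl, hadj, hp⟩ | ⟨a, b, rfl, rfl, hadj, hp⟩
  · exact ⟨hadj, hp.trans (h₁ _ a.2 b.2)⟩
  · exact ⟨hadj, hp.trans (h₂ _ a.2 b.2)⟩

theorem bigAdj_glue_inj (hx : ord x < p) (hx' : ord x.flip < p)
    (hgood : ∀ d : T.Dart, d.fst ∈ side T d₁ → d.snd ∈ side T d₁ → d.fst ∈ side T d₂ →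
      d.snd ∈ side T d₂ → ord (L₁ d) < p ∨ ord (L₂ d) < p)
    (a b c d : side T d₁ ⊕ side T d₂)
    (h : bigAdj (glue T d₁ d₂) (fun d => glueLabel T L₁ L₂ x d.fst d.snd) ord p a b)
    (h' : bigAdj (glue T d₁ d₂) (fun d => glueLabel T L₁ L₂ x d.fst d.snd) ord p c d)
    (hac : Sum.elim Subtype.val Subtype.val a = (Sum.elim Subtype.val Subtype.val c : W))
    (hbd : Sum.elim Subtype.val Subtype.val b = (Sum.elim Subtype.val Subtype.val d : W)) :
    a = c ∧ b = d := by
  have key : ∀ (a b : side T d₁) (c d : side T d₂), bigAdj T L₁ ord p a b →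
      bigAdj T L₂ ord p c d → (a : W) = c → (b : W) = d → False := by
    rintro ⟨a, ha⟩ ⟨b, hb⟩ ⟨c, hc⟩ ⟨d, hd⟩ ⟨hadj, hp⟩ ⟨hadj', hp'⟩ rfl rfl
    exact (hgood ⟨(a, b), hadj⟩ ha hb hc hd).elim (not_lt.2 hp) (not_lt.2 hp')
  rcases bigAdj_glue hx hx' h with ⟨a, b, rfl, rfl, hp⟩ | ⟨a, b, rfl, rfl, hp⟩ <;>
    rcases bigAdj_glue hx hx' h' with ⟨c, d, rfl, rfl, hp'⟩ | ⟨c, d, rfl, rfl, hp'⟩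
  · exact ⟨congrArg _ (Subtype.ext hac), congrArg _ (Subtype.ext hbd)⟩
  · exact (key a b c d hp hp' hac hbd).elim
  · exact (key c d a b hp' hp hac.symm hbd.symm).elim
  · exact ⟨congrArg _ (Subtype.ext hac), congrArg _ (Subtype.ext hbd)⟩

/-- If every edge surviving in both halves with both copies of order more than `x` strictly drops
its order, then the count of linked pairs of big edges decreases under gluing. -/
theorem exists_linkCount_glue_lt [Fintype W] {e f : T.Dart} (hT : T.IsTree)
    (hef : dartLE T e f) (hxf : ord x.flip = ord x)
    (h₁ : ∀ d : T.Dart, d.fst ∈ side T f.symm → d.snd ∈ side T f.symm → ord (L₁ d) ≤ ord (α d))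
    (h₂ : ∀ d : T.Dart, d.fst ∈ side T e → d.snd ∈ side T e → ord (L₂ d) ≤ ord (α d))
    (h₁₂ : ∀ d : T.Dart, d.fst ∈ side T f.symm → d.snd ∈ side T f.symm → d.fst ∈ side T e →
      d.snd ∈ side T e → (ord (L₁ d) < ord (α d) ∧ ord (L₂ d) < ord (α d)) ∨
        ord (L₁ d) ≤ ord x ∨ ord (L₂ d) ≤ ord x)
    (hlt : ∀ g, dartLE T e g → dartLE T g f → ord x < ord (α g)) :
    ∃ r, linkCount (bigAdj (glue T f.symm e)
          (fun d => glueLabel T L₁ L₂ x d.fst d.snd) ord r) < linkCount (bigAdj T α ord r) ∧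
      ∀ p, r ≤ p → linkCount (bigAdj (glue T f.symm e)
          (fun d => glueLabel T L₁ L₂ x d.fst d.snd) ord p) ≤ linkCount (bigAdj T α ord p) := by
  let Dup : Finset T.Dart := {d | d.fst ∈ side T f.symm ∧ d.snd ∈ side T f.symm ∧
    d.fst ∈ side T e ∧ d.snd ∈ side T e ∧ ord x < ord (L₁ d) ∧ ord x < ord (L₂ d)}
  by_cases hne : Dup.Nonempty
  · obtain ⟨m, hm, hmax⟩ := Dup.exists_max_image (fun d => ord (α d)) hne
    obtain ⟨hm1, hm2, hm3, hm4, hm5, hm6⟩ := (Finset.mem_filter.1 hm).2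
    have hdrop := h₁₂ m hm1 hm2 hm3 hm4
    have hxp : ∀ p, ord (α m) ≤ p → ord x < p := by omega
    have hgood : ∀ p, ord (α m) ≤ p → ∀ d : T.Dart, d.fst ∈ side T f.symm →
        d.snd ∈ side T f.symm → d.fst ∈ side T e → d.snd ∈ side T e →
        ord (L₁ d) < p ∨ ord (L₂ d) < p := by
      intro p hp d hd1 hd2 hd3 hd4
      by_contra! hd
      have hmp := hxp p hp
      have := hmax d (Finset.mem_filter.2 ⟨Finset.mem_univ _, hd1, hd2, hd3, hd4, by omega,
        by omega⟩)
      have := h₁₂ d hd1 hd2 hd3 hd4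
      omega
    refine ⟨ord (α m), ?_, fun p hp => ?_⟩
    · refine linkCount_lt _ (bigAdj_glue_hom (hxp _ le_rfl) (hxf ▸ hxp _ le_rfl) h₁ h₂)
        (bigAdj_glue_inj (hxp _ le_rfl) (hxf ▸ hxp _ le_rfl) (hgood _ le_rfl))
        (bigAdj_dart le_rfl) (bigAdj_dart le_rfl) .refl ?_
      rintro a b c d hab - - hma hmb - -
      rcases bigAdj_glue (hxp _ le_rfl) (hxf ▸ hxp _ le_rfl) hab with
        ⟨a, b, rfl, rfl, hadj, hp⟩ | ⟨a, b, rfl, rfl, hadj, hp⟩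
      all_goals
        have hd : (⟨(a, b), hadj⟩ : T.Dart) = m := SimpleGraph.Dart.ext _ _ (Prod.ext hma hmb)
        rw [hd] at hp
        omega
    · exact linkCount_le _ (bigAdj_glue_hom (hxp p hp) (hxf ▸ hxp p hp) h₁ h₂)
        (bigAdj_glue_inj (hxp p hp) (hxf ▸ hxp p hp) (hgood p hp))
  · have hgood : ∀ p, ord x < p → ∀ d : T.Dart, d.fst ∈ side T f.symm →
        d.snd ∈ side T f.symm → d.fst ∈ side T e → d.snd ∈ side T e →
        ord (L₁ d) < p ∨ ord (L₂ d) < p := by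
      intro p hp d hd1 hd2 hd3 hd4
      by_contra! hd
      exact hne ⟨d, Finset.mem_filter.2 ⟨Finset.mem_univ _, hd1, hd2, hd3, hd4, by omega,
        by omega⟩⟩
    refine ⟨ord x + 1, ?_, fun p hp => ?_⟩
    · have hx := Nat.lt_succ_self (ord x)
      obtain ⟨q, hq⟩ := exists_isPath hT e.fst f.snd
      have hbetween := fun g hg => dartLE_of_mem_darts_between hT hef q hq (g := g) hg
      have hq' : ∀ d ∈ q.takeUntil f.fst (q.dart_fst_mem_support_of_mem_darts (hef q hq).2)
          |>.darts, ord x + 1 ≤ ord (α d) := fun d hd =>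
        (hbetween d (q.darts_takeUntil_subset_darts _ hd)).elim (hlt d)
      refine linkCount_lt _ (bigAdj_glue_hom hx (hxf ▸ hx) h₁ h₂)
        (bigAdj_glue_inj hx (hxf ▸ hx) (hgood _ hx))
        (bigAdj_dart (hlt e (dartLE_refl hT e) hef)) (bigAdj_dart (hlt f hef (dartLE_refl hT f)))
        (reflTransGen_bigAdj_of_walk _ hq') ?_
      rintro a b c d hab hcd hac hea - - hfd
      have hleft := isLeft_eq_of_reflTransGen hx (hxf ▸ hx) hac
      rcases bigAdj_glue hx (hxf ▸ hx) hab with ⟨a, b, rfl, rfl, -⟩ | ⟨a, b, rfl, rfl, -⟩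
      · rcases bigAdj_glue hx (hxf ▸ hx) hcd with ⟨c, d, rfl, rfl, -⟩ | ⟨c, d, rfl, rfl, -⟩
        · have hd : f.symm.fst = d := hfd.symm
          exact fst_notMem_side hT f.symm (hd ▸ d.2)
        · cases hleft
      · exact fst_notMem_side hT e (hea ▸ a.2)
    · exact linkCount_le _ (bigAdj_glue_hom (by omega) (by omega) h₁ h₂)
        (bigAdj_glue_inj (by omega) (by omega) (hgood p (by omega)))

end Glue

namespace IsTreeOver

variable {F : Set (Multiset (OSep V))} {k : ℕ}

section Order

variable {W : Type*} [Fintype W] {T : SimpleGraph W} {α : T.Dart → OSep V} {e f d : T.Dart}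
  {c x : OSep V}

theorem ord_symm (h : IsTreeOver F T α) (hord : IsOrderFun S ord)
    (hF : ∀ σ ∈ F, IsStar σ ∧ ∀ s ∈ σ, s ∈ S ∧ ord s < k) (d : T.Dart) :
    ord (α d.symm) = ord (α d) := by
  rw [h.symm, hord.symm _ (h.label_mem hF d).1]

theorem ord_shiftLabel_of_symm_dartLE (h : IsTreeOver F T α) (hU : IsUniverse S)
    (hord : IsOrderFun S ord) (hF : ∀ σ ∈ F, IsStar σ ∧ ∀ s ∈ σ, s ∈ S ∧ ord s < k)
    (hx : x ∈ S) (hd : dartLE T e d.symm) :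
    ord (shiftLabel T α e x d) = ord ((α d.symm).union x) := by
  rw [shiftLabel_of_symm_dartLE h.isTree hd,
    hord.symm _ (hU.union_mem _ (h.label_mem hF _).1 _ hx)]

theorem ord_shiftLabel_symm (h : IsTreeOver F T α) (hU : IsUniverse S)
    (hord : IsOrderFun S ord) (hF : ∀ σ ∈ F, IsStar σ ∧ ∀ s ∈ σ, s ∈ S ∧ ord s < k)
    (hx : x ∈ S) (hd : dartLE T e d ∨ dartLE T e d.symm) :
    ord (shiftLabel T α e x d.symm) = ord (shiftLabel T α e x d) := by
  rcases hd with hd | hd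
  · rw [shiftLabel_of_dartLE hd, h.ord_shiftLabel_of_symm_dartLE hU hord hF hx (by simpa using hd)]
    simp
  · rw [shiftLabel_of_dartLE hd, h.ord_shiftLabel_of_symm_dartLE hU hord hF hx hd]

theorem ord_shiftLabel_le (h : IsTreeOver F T α) (hU : IsUniverse S)
    (hord : IsOrderFun S ord) (hF : ∀ σ ∈ F, IsStar σ ∧ ∀ s ∈ σ, s ∈ S ∧ ord s < k)
    (hx : IsMinBetween S ord (α e) c x) (h1 : d.fst ∈ side T e) (h2 : d.snd ∈ side T e) :
    ord (shiftLabel T α e x d) ≤ ord (α d) := by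
  have key : ∀ g, dartLE T e g → ord ((α g).union x) ≤ ord (α g) := fun g hg =>
    hx.ord_union_le hU hord (h.label_mem hF g).1 (h.label_le (fun σ hσ => (hF σ hσ).1) hg)
  rcases dartLE_or_dartLE_symm_of_mem_side h.isTree h1 h2 with hd | hd
  · rw [shiftLabel_of_dartLE hd]
    exact key d hd
  · rw [h.ord_shiftLabel_of_symm_dartLE hU hord hF hx.1 hd, ← h.ord_symm hord hF d]
    exact key _ hd

/-- The minimum-order separation `x` can be chosen such that every edge surviving in both shifts
either drops its order in both or has order at most that of `x` in one of them. -/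
theorem exists_ord_shiftLabel [Finite V] (h : IsTreeOver F T α) (hU : IsUniverse S)
    (hord : IsOrderFun S ord) (hgr : Grounded S ord)
    (hF : ∀ σ ∈ F, IsStar σ ∧ ∀ s ∈ σ, s ∈ S ∧ ord s < k) (hef : dartLE T e f) :
    ∃ x, IsMinBetween S ord (α e) (α f) x ∧ ord x = lam S ord (α e) (α f) ∧
      ∀ d : T.Dart, d.fst ∈ side T f.symm → d.snd ∈ side T f.symm → d.fst ∈ side T e →
        d.snd ∈ side T e → (ord (shiftLabel T α f.symm x.flip d) < ord (α d) ∧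
          ord (shiftLabel T α e x d) < ord (α d)) ∨
            ord (shiftLabel T α f.symm x.flip d) ≤ ord x ∨ ord (shiftLabel T α e x d) ≤ ord x := by
  have hT := h.isTree
  have hS := fun d => (h.label_mem hF d).1
  have hle := fun {d d'} => h.label_le (fun σ hσ => (hF σ hσ).1) (d := d) (d' := d')
  obtain ⟨x₀, hx₀, hlam⟩ := exists_isMinBetween (S := S) (ord := ord) (hS e) (hle hef)
  obtain ⟨x, hx, hcross⟩ := hx₀.exists_uncrossed hU hord
    (fun i : {d : T.Dart // dartLE T e d ∧ dartLE T f.symm d} => α i) (fun i => hS i)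
    (fun i => hle i.2.1) (fun i => h.symm f ▸ hle i.2.2) fun i j => by
      rw [← h.symm]
      exact (dartLE_or_dartLE_or_symm_dartLE hT i.2.1 j.2.1).imp hle (Or.imp hle hle)
  have hxx₀ : ord x = ord x₀ := le_antisymm (hx.2.2.2 _ hx₀.1 hx₀.2.1 hx₀.2.2.1)
    (hx₀.2.2.2 _ hx.1 hx.2.1 hx.2.2.1)
  have hxS := hU.flip_mem x hx.1
  have key : ∀ d : T.Dart, dartLE T e d → dartLE T f.symm d ∨ dartLE T f.symm d.symm →
      (ord (shiftLabel T α f.symm x.flip d) < ord (α d) ∧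
        ord (shiftLabel T α e x d) < ord (α d)) ∨
      ord (shiftLabel T α f.symm x.flip d) ≤ ord x ∨ ord (shiftLabel T α e x d) ≤ ord x := by
    rintro d hd (hd' | hd')
    · rw [shiftLabel_of_dartLE hd, shiftLabel_of_dartLE hd']
      rcases hcross ⟨d, hd, hd'⟩ with hc | hc
      · exact Or.inr (ord_union_flip_le hU hord hgr hx.1 (hS d) hc).symm
      · exact Or.inl hc.symm
    · rw [shiftLabel_of_dartLE hd, h.ord_shiftLabel_of_symm_dartLE hU hord hF hxS hd', h.symm]
      exact (hx.ord_copies_of_between hU hord (hS d)).imp And.symm Or.symm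
  refine ⟨x, hx, hxx₀.trans hlam, fun d h1 h2 h3 h4 => ?_⟩
  have hf := dartLE_or_dartLE_symm_of_mem_side hT h1 h2
  have he := dartLE_or_dartLE_symm_of_mem_side hT h3 h4
  rcases he with hd | hd
  · exact key d hd hf
  · have := key d.symm hd (by simpa using hf.symm)
    rwa [h.ord_symm hord hF, h.ord_shiftLabel_symm hU hord hF hxS hf,
      h.ord_shiftLabel_symm hU hord hF hx.1 (Or.inr hd)] at this

end Order

/-- Moving a tree over `F` along a bijection of its vertex set with `Fin n`. -/
theorem exists_fin {W : Type*} [Fintype W] {T : SimpleGraph W} {α : T.Dart → OSep V}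
    (h : IsTreeOver F T α) :
    ∃ (n : ℕ) (T' : SimpleGraph (Fin n)) (α' : T'.Dart → OSep V), IsTreeOver F T' α' ∧
      ∀ p, linkCount (bigAdj T' α' ord p) ≤ linkCount (bigAdj T α ord p) := by
  let φ := (Fintype.equivFin W).symm
  refine ⟨Fintype.card W, T.comap φ, fun d => α ⟨(φ d.fst, φ d.snd), d.adj⟩,
    ⟨(SimpleGraph.Iso.comap φ T).isTree_iff.2 h.isTree,
      fun d => h.symm ⟨(φ d.fst, φ d.snd), d.adj⟩, fun t => ?_⟩,
    fun p => ?_⟩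
  · rw [starAt_eq_of_bij (T := T) (α := α) (t := φ t) φ (fun a h => h)
      (fun a b _ _ hab => φ.injective hab)
      (fun b hb => ⟨φ.symm b, by simpa using hb, by simp⟩) fun a h' h => rfl]
    exact h.mem _
  · exact linkCount_le φ (fun a b ⟨h, hp⟩ => ⟨h, hp⟩) fun a b c d _ _ hac hbd =>
      ⟨φ.injective hac, φ.injective hbd⟩

/-- An unlinked tree over `F` can be replaced by one with fewer linked pairs of big edges. -/
theorem exists_linkCount_lt [Finite V] {n : ℕ} {T : SimpleGraph (Fin n)} {α : T.Dart → OSep V}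
    (h : IsTreeOver F T α) (hU : IsUniverse S) (hord : IsOrderFun S ord) (hgr : Grounded S ord)
    (hF : ∀ σ ∈ F, IsStar σ ∧ ∀ s ∈ σ, s ∈ S ∧ ord s < k)
    (hfix : FixedUnderShifting S ord F) (hlink : ¬ IsLinkedTree S ord T α) :
    ∃ (m : ℕ) (T' : SimpleGraph (Fin m)) (α' : T'.Dart → OSep V), IsTreeOver F T' α' ∧
      ∃ r, linkCount (bigAdj T' α' ord r) < linkCount (bigAdj T α ord r) ∧
        ∀ p, r ≤ p → linkCount (bigAdj T' α' ord p) ≤ linkCount (bigAdj T α ord p) := by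
  have hS := fun d => (h.label_mem hF d).1
  have hle := fun {d d'} => h.label_le (fun σ hσ => (hF σ hσ).1) (d := d) (d' := d')
  obtain ⟨e, f, hef, hne⟩ : ∃ e f : T.Dart, dartLE T e f ∧
      sInf ((fun g => ord (α g)) '' {g | dartLE T e g ∧ dartLE T g f}) ≠
        lam S ord (α e) (α f) := by
    simpa [IsLinkedTree] using hlink
  have hlam : ∀ g, dartLE T e g → dartLE T g f → lam S ord (α e) (α f) ≤ ord (α g) :=
    fun g heg hgf => lam_le (hS g) (hle heg) (hle hgf)
  have hlt : ∀ g, dartLE T e g → dartLE T g f → lam S ord (α e) (α f) < ord (α g) := by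
    refine fun g heg hgf => (hlam g heg hgf).lt_of_ne fun heq => hne (le_antisymm ?_ ?_)
    · exact heq ▸ Nat.sInf_le ⟨g, ⟨heg, hgf⟩, rfl⟩
    · exact le_csInf ⟨_, g, ⟨heg, hgf⟩, rfl⟩ (by rintro _ ⟨g', ⟨h1, h2⟩, rfl⟩; exact hlam g' h1 h2)
  obtain ⟨x, hx, hxlam, hcopies⟩ := h.exists_ord_shiftLabel hU hord hgr hF hef
  have hx' := hx.flip hU hord
  rw [← h.symm] at hx'
  obtain ⟨r, hr, hrle⟩ := exists_linkCount_glue_lt h.isTree hef (hord.symm x hx.1)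
    (fun d => h.ord_shiftLabel_le hU hord hF hx') (fun d => h.ord_shiftLabel_le hU hord hF hx)
    hcopies (fun g heg hgf => hxlam ▸ hlt g heg hgf)
  obtain ⟨m, T', α', h', hcount⟩ := (h.glue hU hord hF hfix hx).exists_fin (ord := ord)
  exact ⟨m, T', α', h', r, (hcount r).trans_lt hr, fun p hp => (hcount p).trans (hrle p hp)⟩

end IsTreeOver

end LinkedTree

/-- Let `S⃗` be a grounded universe of set separations with an order
function, `k ∈ ℕ`, and `F` a family of stars of separations in `S⃗_k` fixed under shifting.
If there exists an `S_k`-tree over `F`, then there exists a linked `S_k`-tree over `F`. -/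
theorem exists_linked_Sk_tree {V : Type*} [Fintype V] (S : Set (OSep V)) (ord : OSep V → ℕ)
    (k : ℕ) (hU : IsUniverse S) (hord : IsOrderFun S ord) (hgr : Grounded S ord)
    (F : Set (Multiset (OSep V)))
    (hF : ∀ σ ∈ F, IsStar σ ∧ ∀ s ∈ σ, s ∈ S ∧ ord s < k)
    (hfix : FixedUnderShifting S ord F)
    (hex : ∃ (n : ℕ) (T : SimpleGraph (Fin n)) (α : T.Dart → OSep V),
      T.IsTree ∧ (∀ d, α d.symm = (α d).flip) ∧ (∀ d, α d ∈ S ∧ ord (α d) < k) ∧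
      (∀ t, starAt T α t ∈ F)) :
    ∃ (n : ℕ) (T : SimpleGraph (Fin n)) (α : T.Dart → OSep V),
      T.IsTree ∧ (∀ d, α d.symm = (α d).flip) ∧ (∀ d, α d ∈ S ∧ ord (α d) < k) ∧
      (∀ t, starAt T α t ∈ F) ∧ IsLinkedTree S ord T α := by
  obtain ⟨n, T, α, hT, hsymm, -, hmem⟩ := hex
  obtain ⟨_, ⟨n, T, α, h, rfl⟩, hmin⟩ := (wellFounded_lexFromTop k).has_min
    {c | ∃ (n : ℕ) (T : SimpleGraph (Fin n)) (α : T.Dart → OSep V), IsTreeOver F T α ∧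
      (fun p => linkCount (bigAdj T α ord p)) = c} ⟨_, n, T, α, ⟨hT, hsymm, hmem⟩, rfl⟩
  refine ⟨n, T, α, h.isTree, h.symm, h.label_mem hF, h.mem, ?_⟩
  by_contra hlink
  obtain ⟨m, T', α', h', hlt⟩ := h.exists_linkCount_lt hU hord hgr hF hfix hlink
  exact hmin _ ⟨m, T', α', h', rfl⟩ ⟨fun p hp => linkCount_bigAdj_eq_zero fun d =>
    (h.label_mem hF d).2.trans_le hp, hlt⟩
end
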